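/- Let n ≥ 1 and let K̂ : ℝ^{n+1} × ℝ^{n} → ℝ, written K̂(q, γ) with q = (q_0,…,q_n) and γ = (γ_1,…,γ_n), be continuously differentiable. Define K(q, p) := −p_0 · K̂(q, p_1/(−p_0), …, p_n/(−p_0)) for p = (p_0,…,p_n) with p_0 ≠ 0. Suppose t ↦ (q(t), p(t)) is a differentiable curve with p_0(t) ≠ 0 for all t, solving Hamilton's equations q̇_i = ∂K/∂p_i(q,p) and ṗ_i = −∂K/∂q_i(q,p) for i = 0,…,n. Set γ_j(t) := p_j(t)/(−p_0(t)) for j = 1,…,n. Then the projected curve (q(t), γ(t)) satisfies the contact vector field equations: q̇_0 = ∑_{ℓ=1}^{n} γ_ℓ · ∂K̂/∂γ_ℓ(q, γ) − K̂(q, γ); q̇_j = ∂K̂/∂γ_j(q, γ) for j = 1,…,n; and γ̇_j = −∂K̂/∂q_j(q, γ) − γ_j · ∂K̂/∂q_0(q, γ) for j = 1,…,n. -/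

import Mathlib

/-- The directional derivative of the homogenization `p ↦ -p_0 f(p/(-p_0))` of `f`. -/
theorem fderiv_homogenization_apply {n : ℕ} {f : (Fin n → ℝ) → ℝ} {p : Fin (n + 1) → ℝ}
    (hp : p 0 ≠ 0) (hf : DifferentiableAt ℝ f (fun j => p j.succ / (-(p 0))))
    (v : Fin (n + 1) → ℝ) :
    fderiv ℝ (fun p' : Fin (n + 1) → ℝ => -(p' 0) * f (fun j => p' j.succ / (-(p' 0)))) p v =
      -(v 0) * f (fun j => p j.succ / (-(p 0))) +
        fderiv ℝ f (fun j => p j.succ / (-(p 0)))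
          (fun j => v j.succ + p j.succ / (-(p 0)) * v 0) := by
  have hproj (i : Fin (n + 1)) :
      HasFDerivAt (fun p' : Fin (n + 1) → ℝ => p' i)
        (ContinuousLinearMap.proj (R := ℝ) (φ := fun _ : Fin (n + 1) => ℝ) i) p :=
    hasFDerivAt_apply i p
  have hγ := hasFDerivAt_pi.2 fun j : Fin n =>
    (hproj j.succ).fun_mul
      ((hasDerivAt_inv (neg_ne_zero.2 hp)).comp_hasFDerivAt p (hproj 0).fun_neg)
  have hK := (hproj 0).fun_neg.fun_mul (hf.hasFDerivAt.comp p hγ)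
  have hv : (fun j : Fin n => v j.succ + p j.succ / (-(p 0)) * v 0) =
      (-(p 0)) • (ContinuousLinearMap.pi fun j : Fin n => p j.succ •
          (-((-(p 0)) ^ 2)⁻¹ • -ContinuousLinearMap.proj (R := ℝ)
            (φ := fun _ : Fin (n + 1) => ℝ) 0) +
        (-(p 0))⁻¹ • ContinuousLinearMap.proj (R := ℝ)
          (φ := fun _ : Fin (n + 1) => ℝ) j.succ) v := by
    ext j
    simp
    field_simp
    ring
  rw [hv, map_smul]
  refine (congrArg (fun L => L v) hK.fderiv).trans ?_
  simp [div_eq_mul_inv]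
  ring

/-- Projection of a homogeneous Hamiltonian flow to the contact vector field: if
`K(q,p) = -p_0 K̂(q, p/(-p_0))` and `t ↦ (q(t),p(t))` solves Hamilton's equations for `K`
with `p_0(t) ≠ 0`, then with `γ_j = p_j/(-p_0)` the projected curve `(q(t),γ(t))`
satisfies the contact vector field equations of the contact Hamiltonian `K̂`. -/
theorem stmt_13 (n : ℕ) (hn : 1 ≤ n)
    (Khat : (Fin (n+1) → ℝ) → (Fin n → ℝ) → ℝ)
    (hK : ContDiff ℝ 1 (fun x : (Fin (n+1) → ℝ) × (Fin n → ℝ) => Khat x.1 x.2))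
    (q p : ℝ → Fin (n+1) → ℝ)
    (hq_diff : ∀ i : Fin (n+1), Differentiable ℝ (fun s => q s i))
    (hp_diff : ∀ i : Fin (n+1), Differentiable ℝ (fun s => p s i))
    (hp0 : ∀ t, p t 0 ≠ 0)
    (hq : ∀ (t : ℝ) (i : Fin (n+1)), HasDerivAt (fun s => q s i)
      (fderiv ℝ (fun p' : Fin (n+1) → ℝ =>
          -(p' 0) * Khat (q t) (fun j => p' j.succ / (-(p' 0)))) (p t) (Pi.single i 1)) t)
    (hpd : ∀ (t : ℝ) (i : Fin (n+1)), HasDerivAt (fun s => p s i)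
      (-(fderiv ℝ (fun q' =>
          -(p t 0) * Khat q' (fun j => p t j.succ / (-(p t 0)))) (q t) (Pi.single i 1))) t)
    (t : ℝ) :
    HasDerivAt (fun s => q s 0)
      ((∑ l, (p t l.succ / (-(p t 0))) *
          fderiv ℝ (Khat (q t)) (fun j => p t j.succ / (-(p t 0))) (Pi.single l 1))
        - Khat (q t) (fun j => p t j.succ / (-(p t 0)))) t
    ∧ (∀ j : Fin n, HasDerivAt (fun s => q s j.succ)
        (fderiv ℝ (Khat (q t)) (fun j' => p t j'.succ / (-(p t 0))) (Pi.single j 1)) t)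
    ∧ (∀ j : Fin n, HasDerivAt (fun s => p s j.succ / (-(p s 0)))
        (-(fderiv ℝ (fun q' => Khat q' (fun j' => p t j'.succ / (-(p t 0)))) (q t)
            (Pi.single j.succ 1))
          - (p t j.succ / (-(p t 0))) *
            fderiv ℝ (fun q' => Khat q' (fun j' => p t j'.succ / (-(p t 0)))) (q t)
              (Pi.single 0 1)) t) := by
  set γ : Fin n → ℝ := fun j => p t j.succ / (-(p t 0)) with hγ_def
  have hK_diff : Differentiable ℝ (fun x : (Fin (n+1) → ℝ) × (Fin n → ℝ) => Khat x.1 x.2) :=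
    hK.differentiable one_ne_zero
  have hγ_diff : DifferentiableAt ℝ (Khat (q t)) γ :=
    (hK_diff (q t, γ)).comp γ (f := fun y => (q t, y)) (by fun_prop)
  have hq_diffAt : DifferentiableAt ℝ (fun q' => Khat q' γ) (q t) :=
    (hK_diff (q t, γ)).comp (q t) (f := fun y => (y, γ)) (by fun_prop)
  refine ⟨?_, fun j => ?_, fun j => ?_⟩
  · convert hq t 0 using 1
    rw [fderiv_homogenization_apply (hp0 t) hγ_diff]
    have hsingle (l : Fin n) :
        (fun j => if l = j then (1 : ℝ) else 0) = Pi.single l 1 := by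
      ext j
      simp [Pi.single_apply, eq_comm]
    have hsum := (fderiv ℝ (Khat (q t)) γ).toLinearMap.pi_apply_eq_sum_univ γ
    simp only [ContinuousLinearMap.coe_coe, smul_eq_mul] at hsum
    simp only [Pi.single_eq_same, Pi.single_eq_of_ne (Fin.succ_ne_zero _), zero_add, mul_one]
    change _ = -1 * Khat (q t) γ + fderiv ℝ (Khat (q t)) γ γ
    rw [hsum]
    simp only [hsingle]
    ring
  · convert hq t j.succ using 1
    rw [fderiv_homogenization_apply (hp0 t) hγ_diff]
    have hv : (fun i : Fin n => (Pi.single j.succ 1 : Fin (n+1) → ℝ) i.succ +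
        p t i.succ / (-(p t 0)) * (Pi.single j.succ 1 : Fin (n+1) → ℝ) 0) = Pi.single j 1 := by
      ext i
      simp [Pi.single_apply, (Fin.succ_ne_zero j).symm]
    rw [hv]
    simp [(Fin.succ_ne_zero j).symm, hγ_def]
  · have hp (i : Fin (n+1)) : HasDerivAt (fun s => p s i)
        (p t 0 * fderiv ℝ (fun q' => Khat q' γ) (q t) (Pi.single i 1)) t := by
      convert hpd t i using 1
      rw [fderiv_const_mul hq_diffAt]
      simp
    refine ((hp j.succ).fun_div (hp 0).fun_neg (neg_ne_zero.2 (hp0 t))).congr_deriv ?_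
    have := hp0 t
    field_simp
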